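/- Let 2 < q < ∞ and for each n let X̃^{(n)} be uniformly distributed on D̃_{q,1}^n = n^{1/q} B_{q,1}^n. Then √n · (‖X̃^{(n)}‖_∞ - μ_{q,n}) converges in distribution, as n → ∞, to a centered Gaussian random variable with variance σ_q^2 = 1/(q(q-1)^2(q-2)), where μ_{q,n} := (1/n) Σ_{j=1}^n n^{1/q}/κ_q(j). -/

import Mathlib

open MeasureTheory Finset Filter
open scoped ENNReal NNReal

noncomputable section

/-- `sortedAbs x i` is the `i`-th largest value among `|x 0|, …, |x (n-1)|`
(`i = 0` gives the largest), i.e. the non-increasing rearrangement of `|x|`. -/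
def sortedAbs {n : ℕ} (x : Fin n → ℝ) (i : Fin n) : ℝ :=
  |x (Tuple.sort (fun j => |x j|) i.rev)|

/-- The Lorentz norm `‖x‖_{q,1} = ∑_{i=1}^n i^{1/q-1} x_i^*` for `1 ≤ q < ∞`. -/
def lorentzNorm (q : ℝ) {n : ℕ} (x : Fin n → ℝ) : ℝ :=
  ∑ i : Fin n, ((i : ℝ) + 1) ^ (1 / q - 1) * sortedAbs x i

/-- The unit ball of the Lorentz space `ℓ_{q,1}^n`. -/
def lorentzBall (q : ℝ) (n : ℕ) : Set (Fin n → ℝ) :=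
  {x | lorentzNorm q x ≤ 1}

/-- The normalized Lorentz ball `D̃_{q,1}^n = n^{1/q} B_{q,1}^n`. -/
def scaledLorentzBall (q : ℝ) (n : ℕ) : Set (Fin n → ℝ) :=
  (fun x => ((n : ℝ) ^ (1 / q)) • x) '' lorentzBall q n

/-- The uniform probability measure on a set (normalized restricted Lebesgue measure). -/
def unifOn {n : ℕ} (s : Set (Fin n → ℝ)) : Measure (Fin n → ℝ) :=
  (volume s)⁻¹ • volume.restrict s

/-- `kappa q j = κ_q(j) = ∑_{i=1}^j i^{1/q-1}`. -/
def kappa (q : ℝ) (j : ℕ) : ℝ := ∑ i ∈ Finset.range j, ((i : ℝ) + 1) ^ (1 / q - 1)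

/-- The centering `μ_{q,n} = (1/n) ∑_{j=1}^n n^{1/q}/κ_q(j)`. -/
def muqn (q : ℝ) (n : ℕ) : ℝ :=
  (1 / (n : ℝ)) * ∑ j ∈ Finset.range n, (n : ℝ) ^ (1 / q) / kappa q (j + 1)

section Asymptotics

lemma mul_rpow_sub_one_le_rpow_sub {β : ℝ} (h0 : 0 ≤ β) (h1 : β ≤ 1) {x : ℝ} (hx : 1 ≤ x) :
    β * x ^ (β - 1) ≤ x ^ β - (x - 1) ^ β := by
  have hx0 : 0 < x := by linarith
  have h := rpow_one_add_le_one_add_mul_self (s := -(1 / x)) (p := β)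
    (by rw [neg_le_neg_iff, div_le_one hx0]; exact hx) h0 h1
  have e : x - 1 = x * (1 + -(1 / x)) := by field_simp; ring
  rw [e, Real.mul_rpow hx0.le
    (by have := (div_le_one hx0).2 hx; linarith), Real.rpow_sub_one hx0.ne']
  have hp := Real.rpow_nonneg hx0.le β
  have := mul_le_mul_of_nonneg_left h hp
  have e2 : x ^ β * (1 + β * -(1 / x)) = x ^ β - β * (x ^ β / x) := by
    field_simp; ring
  linarith

lemma rpow_sub_le_mul_rpow_sub_one {β : ℝ} (h0 : 0 ≤ β) (h1 : β ≤ 1) {x : ℝ} (hx : 0 < x) :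
    (x + 1) ^ β - x ^ β ≤ β * x ^ (β - 1) := by
  have h := rpow_one_add_le_one_add_mul_self (s := 1 / x) (p := β)
    (by have : 0 < 1 / x := by positivity
        linarith) h0 h1
  have e : x + 1 = x * (1 + 1 / x) := by field_simp
  rw [e, Real.mul_rpow hx.le (by positivity), Real.rpow_sub_one hx.ne']
  have hp := Real.rpow_nonneg hx.le β
  have := mul_le_mul_of_nonneg_left h hp
  have e2 : x ^ β * (1 + β * (1 / x)) = x ^ β + β * (x ^ β / x) := by field_simp
  linarith

lemma tendsto_rpow_neg_mul_sum_rpow {β : ℝ} (h0 : 0 < β) (h1 : β ≤ 1) :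
    Tendsto (fun n : ℕ => (n : ℝ) ^ (-β) * ∑ k ∈ range n, ((k : ℝ) + 1) ^ (β - 1))
      atTop (nhds β⁻¹) := by
  have upper (n : ℕ) : ∑ k ∈ range n, ((k : ℝ) + 1) ^ (β - 1) ≤ β⁻¹ * (n : ℝ) ^ β := by
    have hs := Finset.sum_range_sub (fun k : ℕ => (k : ℝ) ^ β) n
    simp only [Nat.cast_zero, Real.zero_rpow h0.ne', sub_zero] at hs
    rw [← hs, Finset.mul_sum]
    refine Finset.sum_le_sum fun k _ => ?_
    have := mul_rpow_sub_one_le_rpow_sub h0.le h1 (x := (k : ℝ) + 1) (by simp)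
    rw [le_inv_mul_iff₀ h0]
    simpa using this
  have lower (n : ℕ) : β⁻¹ * ((n : ℝ) ^ β - 1) ≤ ∑ k ∈ range n, ((k : ℝ) + 1) ^ (β - 1) := by
    have hs := Finset.sum_range_sub (fun k : ℕ => ((k : ℝ) + 1) ^ β) n
    have hn : (n : ℝ) ^ β - 1 ≤ ((n : ℝ) + 1) ^ β - 1 := by
      gcongr
      linarith
    simp only [Nat.cast_zero, zero_add, Real.one_rpow] at hs
    rw [inv_mul_le_iff₀ h0]
    refine hn.trans ?_
    rw [← hs, Finset.mul_sum]
    refine Finset.sum_le_sum fun k _ => ?_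
    have := rpow_sub_le_mul_rpow_sub_one h0.le h1 (x := (k : ℝ) + 1) (by positivity)
    simpa using this
  have hlim : Tendsto (fun n : ℕ => β⁻¹ * (1 - (n : ℝ) ^ (-β))) atTop (nhds β⁻¹) := by
    have := ((tendsto_rpow_neg_atTop h0).comp tendsto_natCast_atTop_atTop).const_sub 1
    simpa using this.const_mul β⁻¹
  refine tendsto_of_tendsto_of_tendsto_of_le_of_le' hlim tendsto_const_nhds ?_ ?_
  · filter_upwards [eventually_gt_atTop 0] with n hn
    have hn' : (0 : ℝ) < n := by exact_mod_cast hn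
    have hp : (n : ℝ) ^ (-β) * (n : ℝ) ^ β = 1 := by
      rw [← Real.rpow_add hn']; simp
    calc β⁻¹ * (1 - (n : ℝ) ^ (-β))
        = β⁻¹ * ((n : ℝ) ^ (-β) * (n : ℝ) ^ β - (n : ℝ) ^ (-β)) := by rw [hp]
      _ = (n : ℝ) ^ (-β) * (β⁻¹ * ((n : ℝ) ^ β - 1)) := by ring
      _ ≤ _ := mul_le_mul_of_nonneg_left (lower n) (by positivity)
  · filter_upwards [eventually_gt_atTop 0] with n hn
    have hn' : (0 : ℝ) < n := by exact_mod_cast hn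
    have hp : (n : ℝ) ^ (-β) * (n : ℝ) ^ β = 1 := by
      rw [← Real.rpow_add hn']; simp
    calc _ ≤ (n : ℝ) ^ (-β) * (β⁻¹ * (n : ℝ) ^ β) :=
          mul_le_mul_of_nonneg_left (upper n) (by positivity)
      _ = ((n : ℝ) ^ (-β) * (n : ℝ) ^ β) * β⁻¹ := by ring
      _ = β⁻¹ := by rw [hp, one_mul]

lemma tendsto_rpow_neg_mul_sum {β L : ℝ} (h0 : 0 < β) (h1 : β ≤ 1) {b : ℕ → ℝ}
    (hb : Tendsto (fun k : ℕ => b k * ((k : ℝ) + 1) ^ (1 - β)) atTop (nhds L)) :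
    Tendsto (fun n : ℕ => (n : ℝ) ^ (-β) * ∑ k ∈ range n, b k) atTop (nhds (L * β⁻¹)) := by
  set w : ℕ → ℝ := fun k => ((k : ℝ) + 1) ^ (β - 1) with hw
  have hwpos (k : ℕ) : 0 < w k := by positivity
  have hw1 (k : ℕ) : w k * ((k : ℝ) + 1) ^ (1 - β) = 1 := by
    simp only [hw]
    rw [← Real.rpow_add (by positivity)]; simp
  have hS := tendsto_rpow_neg_mul_sum_rpow h0 h1
  have hdiv : Tendsto (fun n => ∑ i ∈ range n, w i) atTop atTop := by
    have h2 : Tendsto (fun n : ℕ => (n : ℝ) ^ β) atTop atTop :=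
      (tendsto_rpow_atTop h0).comp tendsto_natCast_atTop_atTop
    refine (h2.atTop_mul_pos (inv_pos.2 h0) hS).congr' ?_
    filter_upwards [eventually_gt_atTop 0] with n hn
    have hn' : (0 : ℝ) < n := by exact_mod_cast hn
    rw [← mul_assoc, ← Real.rpow_add hn']
    simp [hw]
  have ho : (fun k => b k - L * w k) =o[atTop] w := by
    rw [Asymptotics.isLittleO_iff_tendsto (fun k hk => absurd hk (hwpos k).ne')]
    have := hb.sub_const L
    rw [sub_self] at this
    refine this.congr fun k => ?_
    rw [eq_div_iff (hwpos k).ne', sub_mul, mul_assoc, mul_comm (_ ^ _), hw1, mul_one]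
  have hs := ho.sum_range (fun k => (hwpos k).le) hdiv
  have hS' : (fun n => ∑ i ∈ range n, w i) =O[atTop] fun n : ℕ => (n : ℝ) ^ β := by
    refine Asymptotics.isBigO_of_div_tendsto_nhds ?_ _ (hS.congr' ?_)
    · filter_upwards [eventually_gt_atTop 0] with n hn h
      have hn' : (0 : ℝ) < n := by exact_mod_cast hn
      exact absurd h (by positivity)
    · filter_upwards with n
      rw [Real.rpow_neg (by positivity), Pi.div_apply, div_eq_inv_mul]
  have h3 := (hs.trans_isBigO hS').tendsto_div_nhds_zero
  have h4 := h3.add (hS.const_mul L)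
  rw [zero_add] at h4
  refine h4.congr fun n => ?_
  rw [Finset.sum_sub_distrib, ← Finset.mul_sum, Real.rpow_neg (by positivity)]
  simp only [hw]
  ring

lemma kappa_succ (q : ℝ) (j : ℕ) : kappa q (j + 1) = kappa q j + ((j : ℝ) + 1) ^ (1 / q - 1) :=
  Finset.sum_range_succ _ _

lemma one_le_kappa_succ (q : ℝ) (j : ℕ) : 1 ≤ kappa q (j + 1) := by
  induction j with
  | zero => simp [kappa]
  | succ k ih =>
    rw [kappa_succ]
    have : (0 : ℝ) ≤ (((k + 1 : ℕ) : ℝ) + 1) ^ (1 / q - 1) := by positivity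
    linarith

lemma kappa_succ_pos (q : ℝ) (j : ℕ) : 0 < kappa q (j + 1) :=
  zero_lt_one.trans_le (one_le_kappa_succ q j)

lemma tendsto_rpow_neg_mul_kappa {q : ℝ} (hq : 1 ≤ q) :
    Tendsto (fun n : ℕ => (n : ℝ) ^ (-(1 / q)) * kappa q n) atTop (nhds q) := by
  have h := tendsto_rpow_neg_mul_sum_rpow (β := 1 / q) (by positivity)
    (by rw [div_le_one (by positivity)]; exact hq)
  simpa [kappa] using h

lemma tendsto_sum_inv_kappa_pow {q : ℝ} (hq : 1 ≤ q) (p : ℕ) (hp : p < q) :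
    Tendsto (fun n : ℕ => (1 / (n : ℝ)) * ∑ j ∈ range n, ((n : ℝ) ^ (1 / q) / kappa q (j + 1)) ^ p)
      atTop (nhds ((q⁻¹) ^ p * (1 - p / q)⁻¹)) := by
  have hq0 : 0 < q := by linarith
  have h := tendsto_rpow_neg_mul_sum (β := 1 - p / q) (L := (q⁻¹) ^ p)
    (b := fun j => ((kappa q (j + 1))⁻¹) ^ p) (by rw [sub_pos, div_lt_one hq0]; exact hp)
    (by have : 0 ≤ (p : ℝ) / q := by positivity
        linarith) ?_
  · refine h.congr' ?_
    filter_upwards [eventually_gt_atTop 0] with n hn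
    have hn' : (0 : ℝ) < n := by exact_mod_cast hn
    have e : (n : ℝ) ^ (-(1 - p / q)) = (1 / n) * ((n : ℝ) ^ (1 / q)) ^ p := by
      rw [← Real.rpow_natCast, ← Real.rpow_mul hn'.le, one_div, ← Real.rpow_neg_one,
        ← Real.rpow_add hn']
      congr 1; ring
    simp only [div_pow, e, Finset.mul_sum]
    refine Finset.sum_congr rfl fun j _ => ?_
    simp only [inv_pow]
    ring
  · have h1 := (((tendsto_rpow_neg_mul_kappa hq).comp (tendsto_add_atTop_nat 1)).inv₀ hq0.ne').pow p
    refine h1.congr fun k => ?_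
    simp only [Function.comp_apply, mul_inv, mul_pow, sub_sub_cancel]
    rw [mul_comm]
    congr 1
    rw [← Real.rpow_neg (by positivity), ← Real.rpow_natCast, ← Real.rpow_mul (by positivity)]
    push_cast
    congr 1; ring

lemma tendsto_muqn {q : ℝ} (hq : 2 < q) :
    Tendsto (muqn q) atTop (nhds (1 / (q - 1))) := by
  have h := tendsto_sum_inv_kappa_pow (q := q) (by linarith) 1 (by push_cast; linarith)
  have e : (q⁻¹) ^ 1 * (1 - (1 : ℕ) / q)⁻¹ = 1 / (q - 1) := by
    have : q - 1 ≠ 0 := by linarith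
    push_cast; field_simp
  rw [e] at h
  exact h.congr fun n => by simp only [pow_one, muqn]

/-- The weight of the `j`-th exponential variable in the centred and rescaled sup norm. -/
def centredWeight (q : ℝ) (n j : ℕ) : ℝ :=
  ((n : ℝ) ^ (1 / q) / kappa q (j + 1) - muqn q n) / Real.sqrt n

lemma sum_centredWeight (q : ℝ) (n : ℕ) : ∑ j ∈ range n, centredWeight q n j = 0 := by
  rcases Nat.eq_zero_or_pos n with rfl | hn
  · simp
  have hn' : (n : ℝ) ≠ 0 := by exact_mod_cast hn.ne'
  simp only [centredWeight]
  rw [← Finset.sum_div, Finset.sum_sub_distrib, Finset.sum_const, card_range, nsmul_eq_mul, muqn,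
    ← mul_assoc, mul_one_div_cancel hn', one_mul, sub_self, zero_div]

lemma tendsto_sum_centredWeight_sq {q : ℝ} (hq : 2 < q) :
    Tendsto (fun n => ∑ j ∈ range n, centredWeight q n j ^ 2) atTop
      (nhds (1 / (q * (q - 1) ^ 2 * (q - 2)))) := by
  have h2 := tendsto_sum_inv_kappa_pow (q := q) (by linarith) 2 (by push_cast; linarith)
  have h := h2.sub ((tendsto_muqn hq).pow 2)
  have e : (q⁻¹) ^ 2 * (1 - (2 : ℕ) / q)⁻¹ - (1 / (q - 1)) ^ 2
      = 1 / (q * (q - 1) ^ 2 * (q - 2)) := by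
    have : q - 1 ≠ 0 := by linarith
    have : q - 2 ≠ 0 := by linarith
    have : q ≠ 0 := by linarith
    push_cast; field_simp; ring
  rw [e] at h
  refine h.congr' ?_
  filter_upwards [eventually_gt_atTop 0] with n hn
  have hn' : (0 : ℝ) < n := by exact_mod_cast hn
  simp only [centredWeight, div_pow, Real.sq_sqrt hn'.le]
  rw [← Finset.sum_div]
  have e3 : ∑ j ∈ range n, (n : ℝ) ^ (1 / q) / kappa q (j + 1) = n * muqn q n := by
    rw [muqn]; field_simp
  simp only [sub_sq, Finset.sum_add_distrib, Finset.sum_sub_distrib, ← Finset.sum_mul,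
    ← Finset.mul_sum, e3, Finset.sum_const, card_range, nsmul_eq_mul, div_pow]
  field_simp
  ring

lemma abs_centredWeight_le {q : ℝ} {n j : ℕ} (hj : j < n) :
    |centredWeight q n j| ≤ (n : ℝ) ^ (1 / q - 1 / 2) := by
  have hn' : (0 : ℝ) < n := by exact_mod_cast (Nat.zero_le j).trans_lt hj
  have hb (k : ℕ) : (n : ℝ) ^ (1 / q) / kappa q (k + 1) ≤ (n : ℝ) ^ (1 / q) :=
    div_le_self (by positivity) (one_le_kappa_succ q k)
  have h0 (k : ℕ) : 0 ≤ (n : ℝ) ^ (1 / q) / kappa q (k + 1) :=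
    div_nonneg (by positivity) (kappa_succ_pos q k).le
  have hm0 : 0 ≤ muqn q n := mul_nonneg (by positivity) (Finset.sum_nonneg fun k _ => h0 k)
  have hm : muqn q n ≤ (n : ℝ) ^ (1 / q) := by
    rw [muqn, one_div, inv_mul_le_iff₀ hn']
    refine (Finset.sum_le_sum fun k _ => hb k).trans ?_
    simp
  rw [centredWeight, abs_div, abs_of_nonneg (Real.sqrt_nonneg _), Real.rpow_sub hn',
    Real.sqrt_eq_rpow]
  refine div_le_div_of_nonneg_right ?_ (by positivity)
  rw [abs_le]
  constructor <;> linarith [hb j, h0 j]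

end Asymptotics

section CentralLimit

open Complex in
lemma norm_log_one_add_sub_quadratic_le {z : ℂ} (hz : ‖z‖ ≤ 1 / 2) :
    ‖log (1 + z) - (z - z ^ 2 / 2)‖ ≤ ‖z‖ ^ 3 := by
  have h := norm_log_sub_logTaylor_le 2 (z := z) (by linarith)
  have e : logTaylor (2 + 1) z = z - z ^ 2 / 2 := by
    simp [logTaylor, Finset.sum_range_succ]
    ring
  rw [e] at h
  refine h.trans ?_
  have h1 : (1 - ‖z‖)⁻¹ ≤ 2 := by
    rw [inv_le_comm₀ (by linarith) (by norm_num)]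
    linarith
  have h3 : 0 ≤ ‖z‖ ^ 3 := by positivity
  have := mul_le_mul_of_nonneg_left h1 h3
  norm_num at this ⊢
  linarith

open Complex in
lemma tendsto_prod_inv_one_add_mul_I {c : ℕ → ℕ → ℝ} {ε : ℕ → ℝ} {v : ℝ}
    (hsum : ∀ n, ∑ j ∈ range n, c n j = 0)
    (hsq : Tendsto (fun n => ∑ j ∈ range n, c n j ^ 2) atTop (nhds v))
    (hε : Tendsto ε atTop (nhds 0)) (hc : ∀ n, ∀ j < n, |c n j| ≤ ε n) (t : ℝ) :
    Tendsto (fun n => ∏ j ∈ range n, (1 - (t * c n j : ℝ) * I)⁻¹) atTop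
      (nhds (exp (-(v * t ^ 2 / 2)))) := by
  set z : ℕ → ℕ → ℂ := fun n j => -((t * c n j : ℝ) * I) with hz
  have hzn (n j : ℕ) : ‖z n j‖ = |t| * |c n j| := by
    simp [hz]
  have hlog : Tendsto (fun n => ∑ j ∈ range n, log (1 + z n j)) atTop
      (nhds (v * t ^ 2 / 2 : ℂ)) := by
    have hmain : Tendsto (fun n => ∑ j ∈ range n, (z n j - z n j ^ 2 / 2)) atTop
        (nhds (v * t ^ 2 / 2 : ℂ)) := by
      have h1 := ((continuous_ofReal.tendsto _).comp (hsq.mul_const (t ^ 2 / 2)))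
      have e : ((v * (t ^ 2 / 2) : ℝ) : ℂ) = v * t ^ 2 / 2 := by push_cast; ring
      rw [e] at h1
      refine h1.congr fun n => ?_
      have h0 : ∑ j ∈ range n, z n j = 0 := by
        simp only [hz, Finset.sum_neg_distrib, ← Finset.sum_mul, ← ofReal_sum, ← Finset.mul_sum,
          hsum n]
        simp
      rw [Finset.sum_sub_distrib, h0, zero_sub, ← Finset.sum_neg_distrib]
      simp only [Function.comp_apply, Finset.sum_mul, ofReal_sum]
      refine Finset.sum_congr rfl fun j _ => ?_
      simp only [hz, neg_sq, mul_pow, I_sq]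
      push_cast
      ring
    have hrem : Tendsto (fun n => ∑ j ∈ range n, (log (1 + z n j) - (z n j - z n j ^ 2 / 2)))
        atTop (nhds 0) := by
      have hb : Tendsto (fun n => |t| ^ 3 * (ε n * ∑ j ∈ range n, c n j ^ 2)) atTop (nhds 0) := by
        simpa using (hε.mul hsq).const_mul (|t| ^ 3)
      have hsmall : ∀ᶠ n in atTop, |t| * ε n < 1 / 2 := by
        have := hε.const_mul |t|
        rw [mul_zero] at this
        exact this.eventually_lt_const (by norm_num)
      refine squeeze_zero_norm' ?_ hb
      filter_upwards [hsmall] with n hn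
      refine (norm_sum_le _ _).trans ?_
      rw [Finset.mul_sum, Finset.mul_sum]
      refine Finset.sum_le_sum fun j hj => ?_
      have hcj := hc n j (Finset.mem_range.1 hj)
      refine (norm_log_one_add_sub_quadratic_le ?_).trans ?_
      · rw [hzn]
        exact (mul_le_mul_of_nonneg_left hcj (abs_nonneg t)).trans hn.le
      · rw [hzn, mul_pow, pow_succ |c n j|, sq_abs, mul_comm (c n j ^ 2)]
        gcongr
    have := hrem.add hmain
    rw [zero_add] at this
    exact this.congr fun n => by rw [← Finset.sum_add_distrib]; simp
  have h2 := (continuous_exp.tendsto _).comp hlog.neg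
  refine h2.congr fun n => ?_
  rw [Function.comp_apply, ← Finset.sum_neg_distrib, exp_sum]
  refine Finset.prod_congr rfl fun j _ => ?_
  have hne : 1 + z n j ≠ 0 := by
    intro h
    have := congrArg re h
    simp [hz] at this
  rw [exp_neg, exp_log hne, hz, sub_eq_add_neg]

open ProbabilityTheory

lemma expMeasure_one : expMeasure 1 =
    (volume.restrict (Set.Ioi (0 : ℝ))).withDensity (fun x => ENNReal.ofReal (Real.exp (-x))) := by
  rw [expMeasure, gammaMeasure, ← withDensity_indicator measurableSet_Ioi]
  refine withDensity_congr_ae ?_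
  have h0 : ∀ᵐ x : ℝ, x ≠ 0 := by simp [ae_iff]
  filter_upwards [h0] with x hx
  change exponentialPDF 1 x = _
  rcases lt_or_gt_of_ne hx with h | h
  · rw [exponentialPDF_of_neg h, Set.indicator_of_notMem (by simpa using h.le)]
  · rw [exponentialPDF_of_nonneg h.le, Set.indicator_of_mem (by simpa using h)]
    simp

lemma lintegral_expMeasure_one {f : ℝ → ℝ≥0∞} (hf : Measurable f) :
    ∫⁻ x, f x ∂(expMeasure 1) = ∫⁻ x in Set.Ioi 0, ENNReal.ofReal (Real.exp (-x)) * f x := by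
  rw [expMeasure_one, lintegral_withDensity_eq_lintegral_mul _ (by fun_prop) hf]
  rfl

instance : IsProbabilityMeasure (expMeasure 1) := isProbabilityMeasure_expMeasure one_pos

lemma integral_expMeasure_one {E : Type*} [NormedAddCommGroup E] [NormedSpace ℝ E] (f : ℝ → E) :
    ∫ x, f x ∂(expMeasure 1) = ∫ x in Set.Ioi 0, Real.exp (-x) • f x := by
  rw [expMeasure_one, integral_withDensity_eq_integral_toReal_smul (by fun_prop) (by simp)]
  simp [Real.exp_nonneg]

lemma charFun_expMeasure_one (t : ℝ) :
    charFun (expMeasure 1) t = (1 - t * Complex.I)⁻¹ := by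
  rw [charFun_apply_real, integral_expMeasure_one]
  have h := integral_exp_mul_complex_Ioi (a := t * Complex.I - 1) (by simp) 0
  have e : ∀ x : ℝ, Real.exp (-x) • Complex.exp (t * x * Complex.I)
      = Complex.exp ((t * Complex.I - 1) * x) := fun x => by
    rw [Complex.real_smul, Complex.ofReal_exp, ← Complex.exp_add]
    congr 1; push_cast; ring
  simp only [e, h, Complex.ofReal_zero, mul_zero, Complex.exp_zero]
  rw [← neg_sub, div_neg, neg_div, neg_neg, one_div]

lemma integrable_id_expMeasure_one : Integrable (fun x : ℝ => x) (expMeasure 1) := by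
  rw [expMeasure_one, integrable_withDensity_iff (by fun_prop) (by simp)]
  have h := Real.GammaIntegral_convergent (s := 2) (by norm_num)
  refine h.congr_fun (fun x hx => ?_) measurableSet_Ioi
  have : (2 : ℝ) - 1 = 1 := by norm_num
  simp [Real.exp_nonneg, this, mul_comm]

lemma integral_id_expMeasure_one : ∫ x : ℝ, x ∂(expMeasure 1) = 1 := by
  rw [integral_expMeasure_one]
  have h := Real.Gamma_eq_integral (s := 2) (by norm_num)
  rw [Real.Gamma_two] at h
  rw [h]
  have : (2 : ℝ) - 1 = 1 := by norm_num
  simp [this]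

/-- The law of a sequence of independent standard exponential variables. -/
def iidExp : Measure (ℕ → ℝ) := Measure.infinitePi fun _ => expMeasure 1

instance : IsProbabilityMeasure iidExp := by unfold iidExp; infer_instance

lemma map_eval_iidExp (i : ℕ) : iidExp.map (fun ω => ω i) = expMeasure 1 :=
  Measure.infinitePi_map_eval _ i

lemma iIndepFun_iidExp : iIndepFun (fun (i : ℕ) (ω : ℕ → ℝ) => ω i) iidExp :=
  iIndepFun_infinitePi (X := fun _ x => x) (by fun_prop)

lemma tendstoInMeasure_div_sum_iidExp :
    TendstoInMeasure iidExp (fun (n : ℕ) ω => n / ∑ j ∈ range (n + 1), ω j) atTop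
      (fun _ => (1 : ℝ)) := by
  refine tendstoInMeasure_of_tendsto_ae
    (fun n => (Measurable.aestronglyMeasurable (by fun_prop))) ?_
  have hint : Integrable (fun ω : ℕ → ℝ => ω 0) iidExp := by
    have := integrable_id_expMeasure_one
    rw [← map_eval_iidExp 0] at this
    exact this.comp_measurable (by fun_prop)
  have hE : ∫ ω, ω 0 ∂iidExp = 1 := by
    have := integral_id_expMeasure_one
    rwa [← map_eval_iidExp 0, integral_map (measurable_pi_apply 0).aemeasurable (by fun_prop)]
      at this
  have h := strong_law_ae (μ := iidExp) (fun (i : ℕ) (ω : ℕ → ℝ) => ω i) hint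
    (fun i j hij => iIndepFun_iidExp.indepFun hij)
    (fun i => ⟨(measurable_pi_apply i).aemeasurable, (measurable_pi_apply 0).aemeasurable, by
      rw [map_eval_iidExp, map_eval_iidExp]⟩)
  rw [hE] at h
  filter_upwards [h] with ω hω
  have h1 := (hω.comp (tendsto_add_atTop_nat 1)).inv₀ one_ne_zero
  have h2 := (tendsto_natCast_div_add_atTop (1 : ℝ)).mul h1
  rw [inv_one, one_mul] at h2
  refine h2.congr fun n => ?_
  have : (n : ℝ) + 1 ≠ 0 := by positivity
  simp only [Function.comp_apply, smul_eq_mul, mul_inv, inv_inv]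
  push_cast
  field_simp

lemma tendstoInDistribution_weighted_sum_iidExp {c : ℕ → ℕ → ℝ} {ε : ℕ → ℝ} {v : ℝ} (hv : 0 ≤ v)
    (hsum : ∀ n, ∑ j ∈ range n, c n j = 0)
    (hsq : Tendsto (fun n => ∑ j ∈ range n, c n j ^ 2) atTop (nhds v))
    (hε : Tendsto ε atTop (nhds 0)) (hc : ∀ n, ∀ j < n, |c n j| ≤ ε n) :
    TendstoInDistribution (fun n (ω : ℕ → ℝ) => ∑ j ∈ range n, c n j * ω (j + 1)) atTop
      (fun x : ℝ => x) (fun _ => iidExp) (gaussianReal 0 v.toNNReal) where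
  forall_aemeasurable n := Measurable.aemeasurable (by fun_prop)
  aemeasurable_limit := by fun_prop
  tendsto := by
    refine ProbabilityMeasure.tendsto_iff_tendsto_charFun.2 fun t => ?_
    have h := tendsto_prod_inv_one_add_mul_I hsum hsq hε hc t
    simp only [ProbabilityMeasure.coe_mk, Measure.map_id', charFun_gaussianReal]
    have e : Complex.exp (t * (0 : ℝ) * Complex.I - (v.toNNReal : ℝ) * t ^ 2 / 2)
        = Complex.exp (-(v * t ^ 2 / 2)) := by
      rw [Real.coe_toNNReal _ hv]; simp
    rw [e]
    refine h.congr fun n => ?_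
    have hind : iIndepFun (fun (j : ℕ) (ω : ℕ → ℝ) => c n j * ω (j + 1)) iidExp :=
      (iIndepFun_iidExp.precomp (add_left_injective 1)).comp (fun j x => c n j * x)
        (fun j => by fun_prop)
    rw [(hind.restrict _).charFun_map_fun_finsetSum_eq_prod 
      (fun _ _ => Measurable.aemeasurable (by fun_prop)),
      Finset.prod_apply]
    refine Finset.prod_congr rfl fun j _ => ?_
    rw [charFun_map_mul_comp (measurable_pi_apply _).aemeasurable, map_eval_iidExp,
      charFun_expMeasure_one, mul_comm t]

end CentralLimit

section Geometry

open ProbabilityTheory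

lemma lintegral_pi_fin_prod (μ : Measure ℝ) [SigmaFinite μ] {n : ℕ} (g : Fin n → ℝ → ℝ≥0∞)
    (hg : ∀ i, Measurable (g i)) :
    ∫⁻ x, ∏ i, g i (x i) ∂(Measure.pi fun _ : Fin n => μ) = ∏ i, ∫⁻ y, g i y ∂μ := by
  induction n with
  | zero => simp
  | succ n ih =>
    rw [← ((measurePreserving_piFinSuccAbove (fun _ : Fin (n + 1) => μ) 0).symm).lintegral_comp
      (by fun_prop)]
    simp only [Fin.prod_univ_succ, MeasurableEquiv.piFinSuccAbove_symm_apply, Fin.insertNthEquiv,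
      Fin.insertNth_zero', Equiv.coe_fn_mk, Fin.cons_zero, Fin.cons_succ]
    rw [lintegral_prod_mul (g := fun y : Fin n → ℝ => ∏ i : Fin n, g i.succ (y i))
      (hg 0).aemeasurable (Measurable.aemeasurable (by fun_prop)),
      ih (fun i => g i.succ) fun i => hg _]

lemma pi_expMeasure_one (n : ℕ) : Measure.pi (fun _ : Fin n => expMeasure 1) =
    (volume.restrict {e : Fin n → ℝ | ∀ i, 0 < e i}).withDensity
      (fun e => ENNReal.ofReal (Real.exp (-∑ i, e i))) := by
  refine (Measure.pi_eq fun s hs => ?_)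
  have hO : {e : Fin n → ℝ | ∀ i, 0 < e i} = Set.univ.pi fun _ => Set.Ioi 0 := by
    ext e; simp
  rw [withDensity_apply _ (MeasurableSet.univ_pi hs), hO, volume_pi, Measure.restrict_pi_pi,
    ← lintegral_indicator (MeasurableSet.univ_pi hs)]
  have e1 (x : Fin n → ℝ) : (Set.univ.pi s).indicator
      (fun e => ENNReal.ofReal (Real.exp (-∑ i, e i))) x =
      ∏ i, (s i).indicator (fun y => ENNReal.ofReal (Real.exp (-y))) (x i) := by
    by_cases hx : x ∈ Set.univ.pi s
    · rw [Set.indicator_of_mem hx, ← Finset.sum_neg_distrib, Real.exp_sum,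
        ENNReal.ofReal_prod_of_nonneg fun _ _ => (Real.exp_nonneg _)]
      exact Finset.prod_congr rfl fun i _ => (Set.indicator_of_mem (hx i trivial)
        (fun y => ENNReal.ofReal (Real.exp (-y)))).symm
    · rw [Set.indicator_of_notMem hx]
      simp only [Set.mem_pi, Set.mem_univ, true_implies, not_forall] at hx
      obtain ⟨i, hi⟩ := hx
      exact (Finset.prod_eq_zero (Finset.mem_univ i) (Set.indicator_of_notMem hi _)).symm
  simp only [e1]
  rw [lintegral_pi_fin_prod _ _ fun i => Measurable.indicator (by fun_prop) (hs i)]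
  refine Finset.prod_congr rfl fun i _ => ?_
  rw [lintegral_indicator (hs i), expMeasure_one, withDensity_apply _ (hs i)]

lemma lintegral_pi_expMeasure_one {n : ℕ} {f : (Fin n → ℝ) → ℝ≥0∞} (hf : Measurable f) :
    ∫⁻ e, f e ∂(Measure.pi fun _ : Fin n => expMeasure 1) =
      ∫⁻ e in {e : Fin n → ℝ | ∀ i, 0 < e i}, ENNReal.ofReal (Real.exp (-∑ i, e i)) * f e := by
  rw [pi_expMeasure_one, lintegral_withDensity_eq_lintegral_mul _ (by fun_prop) hf]
  rfl

/-- Polar integration for a homogeneous gauge `L`: if `x` has density proportional to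
`exp (-L x)` and `s` is an independent standard exponential variable, then `c x / (L x + s)` is
uniform on `{L ≤ c}`. -/
lemma exists_lintegral_exp_neg_gauge {n : ℕ} {L : (Fin n → ℝ) → ℝ} (hL : Measurable L)
    (h0 : ∀ x, 0 ≤ L x) (hhom : ∀ t : ℝ, 0 < t → ∀ x, L (t • x) = t * L x) {c : ℝ} (hc : 0 < c) :
    ∃ C : ℝ≥0∞, ∀ Φ : (Fin n → ℝ) → ℝ≥0∞, Measurable Φ →
      ∫⁻ x, ENNReal.ofReal (Real.exp (-L x)) * ∫⁻ s, Φ ((c / (L x + s)) • x) ∂(expMeasure 1) =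
        C * ∫⁻ x in {x | L x ≤ c}, Φ x := by
  refine ⟨∫⁻ t in Set.Ioi (0 : ℝ),
    ENNReal.ofReal (Real.exp (-t)) * ENNReal.ofReal |((c / t) ^ n)⁻¹|, fun Φ hΦ => ?_⟩
  set k : (Fin n → ℝ) → ℝ → ℝ≥0∞ :=
    fun x t => ENNReal.ofReal (Real.exp (-t)) * Φ ((c / t) • x) with hk
  have hkm : Measurable (Function.uncurry k) := by
    simp only [hk, Function.uncurry_def]
    fun_prop
  set S : Set ((Fin n → ℝ) × ℝ) := {p | 0 < p.2 ∧ L p.1 ≤ p.2} with hS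
  have hSm : MeasurableSet S :=
    (measurableSet_lt measurable_const measurable_snd).inter
      (measurableSet_le (hL.comp measurable_fst) measurable_snd)
  have hinner (x : Fin n → ℝ) :
      ENNReal.ofReal (Real.exp (-L x)) * ∫⁻ s, Φ ((c / (L x + s)) • x) ∂(expMeasure 1) =
        ∫⁻ t, S.indicator (Function.uncurry k) (x, t) := by
    rw [lintegral_expMeasure_one (by fun_prop), ← lintegral_const_mul _ (by fun_prop),
      ← lintegral_indicator measurableSet_Ioi,
      ← lintegral_add_left_eq_self (fun t => S.indicator (Function.uncurry k) (x, t)) (L x)]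
    have hne : ∀ᵐ s : ℝ, s ≠ 0 := by simp [ae_iff]
    refine lintegral_congr_ae ?_
    filter_upwards [hne] with s hs
    rcases lt_or_gt_of_ne hs with h | h
    · rw [Set.indicator_of_notMem (by simpa using h.le), Set.indicator_of_notMem]
      rintro ⟨-, h2⟩
      simp only at h2
      linarith
    · rw [Set.indicator_of_mem (by simpa using h), Set.indicator_of_mem
        (show (x, L x + s) ∈ S from
        ⟨add_pos_of_nonneg_of_pos (h0 x) h, (le_add_iff_nonneg_right _).2 h.le⟩)]
      simp only [Function.uncurry_apply_pair, hk]
      rw [← mul_assoc, ← ENNReal.ofReal_mul (Real.exp_nonneg _), ← Real.exp_add, neg_add]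
  simp only [hinner]
  rw [lintegral_lintegral_swap (f := fun x t => S.indicator (Function.uncurry k) (x, t))
    (hkm.indicator hSm).aemeasurable,
    ← lintegral_mul_const _ (by fun_prop), ← lintegral_indicator measurableSet_Ioi]
  refine lintegral_congr fun t => ?_
  rcases le_or_gt t 0 with ht | ht
  · rw [Set.indicator_of_notMem (by simpa using ht)]
    have : ∀ x, S.indicator (Function.uncurry k) (x, t) = 0 := fun x =>
      Set.indicator_of_notMem (fun h => absurd h.1 (not_lt.2 ht)) _
    simp [this]
  · rw [Set.indicator_of_mem (by simpa using ht)]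
    have hct : 0 < c / t := by positivity
    have hball : MeasurableSet {x | L x ≤ c} := measurableSet_le hL measurable_const
    have e (x : Fin n → ℝ) : S.indicator (Function.uncurry k) (x, t) =
        ENNReal.ofReal (Real.exp (-t)) * {x | L x ≤ c}.indicator Φ ((c / t) • x) := by
      have hiff : (x, t) ∈ S ↔ (c / t) • x ∈ {x | L x ≤ c} := by
        simp only [hS, Set.mem_ofPred_eq, ht, true_and, hhom _ hct]
        rw [div_mul_eq_mul_div, div_le_iff₀ ht, mul_le_mul_iff_right₀ hc]
      by_cases hx : (x, t) ∈ S
      · rw [Set.indicator_of_mem hx, Set.indicator_of_mem (hiff.1 hx)]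
        rfl
      · rw [Set.indicator_of_notMem hx, Set.indicator_of_notMem (fun h => hx (hiff.2 h)), mul_zero]
    have hsmul : Measurable fun x : Fin n → ℝ => (c / t) • x := by fun_prop
    simp only [e]
    rw [lintegral_const_mul _ (by exact (hΦ.indicator hball).comp hsmul),
      ← lintegral_map (hΦ.indicator hball) (by fun_prop), Measure.map_addHaar_smul _ hct.ne',
      lintegral_smul_measure, lintegral_indicator hball]
    simp only [Module.finrank_fin_fun, smul_eq_mul, mul_assoc]

variable {n : ℕ}

lemma sortedAbs_of_antitone {x : Fin n → ℝ} (hx : Antitone fun i => |x i|) (i : Fin n) :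
    sortedAbs x i = |x i| := by
  have h : Monotone ((fun j => |x j|) ∘ (Fin.revPerm : Equiv.Perm (Fin n))) :=
    fun a b hab => hx (Fin.rev_le_rev.2 hab)
  have := congrFun (Tuple.comp_sort_eq_comp_iff_monotone.2 h) i.rev
  simpa [sortedAbs] using this.symm

lemma sortedAbs_congr_perm {x y : Fin n → ℝ} (σ : Equiv.Perm (Fin n))
    (h : ∀ i, |y i| = |x (σ i)|) (i : Fin n) : sortedAbs y i = sortedAbs x i := by
  have e : (fun j => |y j|) = (fun j => |x j|) ∘ σ := funext h
  have := congrFun (Tuple.comp_perm_comp_sort_eq_comp_sort (f := fun j => |x j|) (σ := σ)) i.rev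
  rw [← e] at this
  exact this

lemma sortedAbs_smul {t : ℝ} (ht : 0 < t) (x : Fin n → ℝ) (i : Fin n) :
    sortedAbs (t • x) i = t * sortedAbs x i := by
  have e : (fun j => |(t • x) j|) = fun j => t * |x j| := by
    ext j; simp [abs_mul, abs_of_pos ht]
  have h : Monotone ((fun j => |(t • x) j|) ∘ Tuple.sort fun j => |x j|) := by
    rw [e]
    exact fun a b hab => mul_le_mul_of_nonneg_left (Tuple.monotone_sort (fun j => |x j|) hab) ht.le
  have := congrFun (Tuple.comp_sort_eq_comp_iff_monotone.2 h) i.rev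
  simp only [Function.comp_apply] at this
  rw [sortedAbs, ← this, sortedAbs]
  simp [abs_mul, abs_of_pos ht]

lemma measurable_sort_abs :
    Measurable[_, ⊤] fun x : Fin n → ℝ => Tuple.sort fun j => |x j| := by
  refine @measurable_to_countable' _ _ ⊤ _ _ _ fun σ => ?_
  have : (fun x : Fin n → ℝ => Tuple.sort fun j => |x j|) ⁻¹' {σ} =
      {x | (∀ i j, i ≤ j → |x (σ i)| ≤ |x (σ j)|) ∧
        ∀ i j, i < j → |x (σ i)| = |x (σ j)| → σ i < σ j} := by
    ext x
    rw [Set.mem_preimage, Set.mem_singleton_iff, eq_comm, Tuple.eq_sort_iff]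
    rfl
  rw [this]
  measurability

lemma measurable_sortedAbs (i : Fin n) : Measurable fun x : Fin n → ℝ => sortedAbs x i := by
  let _ : MeasurableSpace (Equiv.Perm (Fin n)) := ⊤
  have : MeasurableSingletonClass (Equiv.Perm (Fin n)) := ⟨fun _ => trivial⟩
  have h : Measurable fun p : (Fin n → ℝ) × Equiv.Perm (Fin n) => |p.1 (p.2 i.rev)| :=
    measurable_from_prod_countable_left fun σ =>
      _root_.continuous_abs.measurable.comp (measurable_pi_apply (σ i.rev))
  exact h.comp (measurable_id.prodMk measurable_sort_abs)

lemma measurable_lorentzNorm (q : ℝ) :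
    Measurable fun x : Fin n → ℝ => lorentzNorm q x :=
  Finset.measurable_sum _ fun i _ => (measurable_sortedAbs i).const_mul _

lemma lorentzNorm_nonneg (q : ℝ) (x : Fin n → ℝ) : 0 ≤ lorentzNorm q x :=
  Finset.sum_nonneg fun _ _ => mul_nonneg (by positivity) (abs_nonneg _)

lemma lorentzNorm_smul (q : ℝ) {t : ℝ} (ht : 0 < t) (x : Fin n → ℝ) :
    lorentzNorm q (t • x) = t * lorentzNorm q x := by
  simp only [lorentzNorm, sortedAbs_smul ht, Finset.mul_sum]
  exact Finset.sum_congr rfl fun i _ => by ring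

/-- The signed permutation of the coordinates given by `σ` and `ε`. -/
def signedPerm (g : Equiv.Perm (Fin n) × (Fin n → ℤˣ)) (x : Fin n → ℝ) : Fin n → ℝ :=
  fun i => ((g.2 i : ℤ) : ℝ) * x (g.1 i)

lemma abs_units_int_cast (u : ℤˣ) : |((u : ℤ) : ℝ)| = 1 := by
  rcases Int.units_eq_one_or u with rfl | rfl <;> simp

lemma abs_signedPerm (g : Equiv.Perm (Fin n) × (Fin n → ℤˣ)) (x : Fin n → ℝ) (i : Fin n) :
    |signedPerm g x i| = |x (g.1 i)| := by
  rw [signedPerm, abs_mul, abs_units_int_cast, one_mul]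

lemma norm_signedPerm (g : Equiv.Perm (Fin n) × (Fin n → ℤˣ)) (x : Fin n → ℝ) :
    ‖signedPerm g x‖ = ‖x‖ := by
  refine le_antisymm ((pi_norm_le_iff_of_nonneg (norm_nonneg _)).2 fun i => ?_)
    ((pi_norm_le_iff_of_nonneg (norm_nonneg _)).2 fun i => ?_)
  · rw [Real.norm_eq_abs, abs_signedPerm]
    exact norm_le_pi_norm x _
  · rw [Real.norm_eq_abs, ← g.1.apply_symm_apply i, ← abs_signedPerm]
    exact norm_le_pi_norm (signedPerm g x) _

lemma lorentzNorm_signedPerm (q : ℝ) (g : Equiv.Perm (Fin n) × (Fin n → ℤˣ)) (x : Fin n → ℝ) :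
    lorentzNorm q (signedPerm g x) = lorentzNorm q x := by
  simp only [lorentzNorm, sortedAbs_congr_perm g.1 (abs_signedPerm g x)]

lemma measurePreserving_signedPerm (g : Equiv.Perm (Fin n) × (Fin n → ℤˣ)) :
    MeasurePreserving (signedPerm g) volume volume := by
  have h1 : MeasurePreserving (fun x : Fin n → ℝ => fun i => ((g.2 i : ℤ) : ℝ) * x i)
      volume volume := by
    refine volume_preserving_pi (f := fun i (y : ℝ) => ((g.2 i : ℤ) : ℝ) * y) fun i => ?_
    rcases Int.units_eq_one_or (g.2 i) with h | h
    · simp only [h, Units.val_one, Int.cast_one, one_mul]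
      exact MeasurePreserving.id _
    · simp only [h, Units.val_neg, Units.val_one, Int.cast_neg, Int.cast_one, neg_one_mul]
      exact Measure.measurePreserving_neg _
  have h2 := volume_preserving_arrowCongr' (g.1.symm) (MeasurableEquiv.refl ℝ)
    (MeasurePreserving.id _)
  exact h1.comp h2

/-- The open cone of positive strictly decreasing vectors. -/
def decreasingCone (n : ℕ) : Set (Fin n → ℝ) := {x | StrictAnti x ∧ ∀ i, 0 < x i}

lemma measurableSet_decreasingCone : MeasurableSet (decreasingCone n) := by
  have : decreasingCone n = {x | (∀ i j, i < j → x j < x i) ∧ ∀ i, 0 < x i} := rfl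
  rw [this]
  measurability

lemma pairwise_disjoint_signedPerm_preimage : Pairwise (Function.onFun Disjoint
    fun g : Equiv.Perm (Fin n) × (Fin n → ℤˣ) => signedPerm g ⁻¹' decreasingCone n) := by
  intro g h hgh
  refine Set.disjoint_left.2 fun x hx hx' => hgh ?_
  have key (g : Equiv.Perm (Fin n) × (Fin n → ℤˣ)) (hx : signedPerm g x ∈ decreasingCone n) :
      StrictAnti ((fun i => |x i|) ∘ g.1) := fun i j hij => by
    have := hx.1 hij
    rw [← abs_of_pos (hx.2 i), ← abs_of_pos (hx.2 j), abs_signedPerm, abs_signedPerm] at this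
    exact this
  have hg := key g hx
  have hh := key h hx'
  have e1 := Tuple.unique_antitone hg.antitone hh.antitone
  have hinj : Function.Injective fun i => |x i| := by
    have := hg.injective.comp g.1.symm.injective
    simpa [Function.comp_assoc] using this
  have eσ : g.1 = h.1 := Equiv.ext fun i => hinj (congrFun e1 i)
  refine Prod.ext eσ (funext fun i => ?_)
  have p1 := hx.2 i
  have p2 := hx'.2 i
  simp only [signedPerm, eσ] at p1 p2
  rcases Int.units_eq_one_or (g.2 i) with a | a <;> rcases Int.units_eq_one_or (h.2 i) with b | b
    <;> rw [a, b] <;> simp [a, b] at p1 p2 <;> linarith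

lemma ae_mem_iUnion_signedPerm_preimage : ∀ᵐ x : Fin n → ℝ,
    x ∈ ⋃ g : Equiv.Perm (Fin n) × (Fin n → ℤˣ), signedPerm g ⁻¹' decreasingCone n := by
  have hker (φ : (Fin n → ℝ) →ₗ[ℝ] ℝ) (hφ : φ ≠ 0) : ∀ᵐ x : Fin n → ℝ, φ x ≠ 0 := by
    have := Measure.addHaar_submodule volume (LinearMap.ker φ)
      (fun h => hφ (LinearMap.ker_eq_top.1 h))
    rw [ae_iff]
    simp only [not_not]
    exact this
  have h0 : ∀ᵐ x : Fin n → ℝ, ∀ i, x i ≠ 0 := by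
    refine ae_all_iff.2 fun i => hker (LinearMap.proj i) fun h => ?_
    simpa using LinearMap.congr_fun h (Pi.single i 1)
  have hne (s : ℝ) : ∀ᵐ x : Fin n → ℝ, ∀ i j, i ≠ j → x i + s * x j ≠ 0 := by
    refine ae_all_iff.2 fun i => ae_all_iff.2 fun j => ?_
    by_cases hij : i = j
    · simp [hij]
    filter_upwards [hker (LinearMap.proj i + s • LinearMap.proj j) fun h => by
      have := LinearMap.congr_fun h (Pi.single i 1)
      simp [Ne.symm hij] at this] with x hx _
    simpa using hx
  filter_upwards [h0, hne 1, hne (-1)] with x hx h1 h2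
  have hinj : Function.Injective fun i => |x i| := by
    intro i j hij
    by_contra hcon
    rcases abs_eq_abs.1 hij with h | h
    · exact h2 i j hcon (by linarith)
    · exact h1 i j hcon (by linarith)
  set σ : Equiv.Perm (Fin n) := Fin.revPerm.trans (Tuple.sort fun i => |x i|) with hσ
  have hanti : StrictAnti fun i => |x (σ i)| := by
    have ha : Antitone fun i => |x (σ i)| := fun i j hij =>
      Tuple.monotone_sort (fun i => |x i|) (Fin.rev_le_rev.2 hij)
    exact ha.strictAnti_of_injective (hinj.comp σ.injective)
  set ε : Fin n → ℤˣ := fun i => if 0 < x (σ i) then 1 else -1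
  have hval (i : Fin n) : signedPerm (σ, ε) x i = |x (σ i)| := by
    simp only [signedPerm, ε]
    split_ifs with h
    · simp [abs_of_pos h]
    · simp [abs_of_nonpos (not_lt.1 h)]
  refine Set.mem_iUnion.2 ⟨(σ, ε), ?_⟩
  have : signedPerm (σ, ε) x = fun i => |x (σ i)| := funext hval
  rw [Set.mem_preimage, this]
  exact ⟨hanti, fun i => abs_pos.2 (hx _)⟩

lemma lintegral_eq_card_mul_setLIntegral_decreasingCone {F : (Fin n → ℝ) → ℝ≥0∞}
    (hF : Measurable F) (hinv : ∀ g x, F (signedPerm g x) = F x) :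
    ∫⁻ x, F x = Fintype.card (Equiv.Perm (Fin n) × (Fin n → ℤˣ)) *
      ∫⁻ x in decreasingCone n, F x := by
  have hcover : (⋃ g : Equiv.Perm (Fin n) × (Fin n → ℤˣ), signedPerm g ⁻¹' decreasingCone n)
      =ᵐ[volume] Set.univ := eventuallyEq_univ.2 ae_mem_iUnion_signedPerm_preimage
  rw [← setLIntegral_univ, ← setLIntegral_congr hcover, lintegral_iUnion (fun g =>
    (measurePreserving_signedPerm g).measurable measurableSet_decreasingCone)
    pairwise_disjoint_signedPerm_preimage, tsum_fintype]
  have h (g : Equiv.Perm (Fin n) × (Fin n → ℤˣ)) :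
      ∫⁻ x in signedPerm g ⁻¹' decreasingCone n, F x = ∫⁻ x in decreasingCone n, F x := by
    rw [← (measurePreserving_signedPerm g).setLIntegral_comp_preimage
      measurableSet_decreasingCone hF]
    simp only [hinv]
  simp only [h, Finset.sum_const, nsmul_eq_mul]
  rfl

/-- The upper triangular matrix whose `j`-th column is `1 / κ_q(j + 1)` on and above the
diagonal. -/
def coneMatrix (q : ℝ) (n : ℕ) : Matrix (Fin n) (Fin n) ℝ :=
  fun i j => if i ≤ j then (kappa q (j + 1))⁻¹ else 0

lemma det_coneMatrix_ne_zero (q : ℝ) (n : ℕ) : (coneMatrix q n).det ≠ 0 := by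
  have h : (coneMatrix q n).BlockTriangular id := fun i j hij => by
    simp [coneMatrix, not_le.2 (show j < i from hij)]
  rw [Matrix.det_of_isUpperTriangular h]
  refine Finset.prod_ne_zero_iff.2 fun i _ => ?_
  simp [coneMatrix, (kappa_succ_pos q i).ne']

lemma toLin'_coneMatrix_apply (q : ℝ) (e : Fin n → ℝ) (i : Fin n) :
    (coneMatrix q n).toLin' e i = ∑ j, if i ≤ j then e j / kappa q (j + 1) else 0 := by
  rw [Matrix.toLin'_apply, Matrix.mulVec, dotProduct]
  refine Finset.sum_congr rfl fun j _ => ?_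
  rw [coneMatrix]
  split_ifs
  · rw [div_eq_inv_mul]
  · rw [zero_mul]

lemma toLin'_coneMatrix_sub (q : ℝ) (e : Fin n → ℝ) {i k : Fin n} (hik : i < k) :
    (coneMatrix q n).toLin' e i - (coneMatrix q n).toLin' e k =
      ∑ j, if i ≤ j ∧ j < k then e j / kappa q (j + 1) else 0 := by
  rw [toLin'_coneMatrix_apply, toLin'_coneMatrix_apply, ← Finset.sum_sub_distrib]
  refine Finset.sum_congr rfl fun j _ => ?_
  by_cases h1 : k ≤ j
  · simp [h1, hik.le.trans h1, not_lt.2 h1]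
  · simp [h1, not_le.1 h1]

lemma toLin'_coneMatrix_mem_decreasingCone (q : ℝ) (e : Fin n → ℝ) :
    (coneMatrix q n).toLin' e ∈ decreasingCone n ↔ ∀ i, 0 < e i := by
  constructor
  · rintro ⟨h1, h2⟩ i
    have key : 0 < e i / kappa q (i + 1) := by
      by_cases hi : (i : ℕ) + 1 < n
      · have hlt : i < (⟨i + 1, hi⟩ : Fin n) := Fin.lt_def.2 (Nat.lt_succ_self _)
        have h := toLin'_coneMatrix_sub q e hlt
        have heq : ∀ j : Fin n, (i ≤ j ∧ j < (⟨i + 1, hi⟩ : Fin n)) ↔ j = i := fun j => by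
          simp only [Fin.le_def, Fin.lt_def, Fin.ext_iff]
          omega
        simp only [heq, Finset.sum_ite_eq', Finset.mem_univ, if_true] at h
        rw [← h]
        exact sub_pos.2 (h1 hlt)
      · have h := toLin'_coneMatrix_apply q e i
        have heq : ∀ j : Fin n, i ≤ j ↔ j = i := fun j => by
          have := j.isLt
          simp only [Fin.le_def, Fin.ext_iff]
          omega
        simp only [heq, Finset.sum_ite_eq', Finset.mem_univ, if_true] at h
        rw [← h]
        exact h2 i
    exact (div_pos_iff_of_pos_right (kappa_succ_pos q i)).1 key
  · intro h
    have hpos (j : Fin n) : 0 < e j / kappa q (j + 1) := div_pos (h j) (kappa_succ_pos q j)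
    refine ⟨fun i k hik => ?_, fun i => ?_⟩
    · rw [← sub_pos, toLin'_coneMatrix_sub q e hik]
      refine Finset.sum_pos' (fun j _ => ?_) ⟨i, Finset.mem_univ _, ?_⟩
      · split_ifs
        exacts [(hpos j).le, le_rfl]
      · rw [if_pos ⟨le_rfl, hik⟩]
        exact hpos i
    · rw [toLin'_coneMatrix_apply]
      refine Finset.sum_pos' (fun j _ => ?_) ⟨i, Finset.mem_univ _, ?_⟩
      · split_ifs
        exacts [(hpos j).le, le_rfl]
      · rw [if_pos le_rfl]
        exact hpos i

lemma lorentzNorm_toLin'_coneMatrix (q : ℝ) {e : Fin n → ℝ} (he : ∀ i, 0 < e i) :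
    lorentzNorm q ((coneMatrix q n).toLin' e) = ∑ j, e j := by
  have hmem := (toLin'_coneMatrix_mem_decreasingCone q e).2 he
  have habs (i : Fin n) : |(coneMatrix q n).toLin' e i| = (coneMatrix q n).toLin' e i :=
    abs_of_pos (hmem.2 i)
  have hanti : Antitone fun i => |(coneMatrix q n).toLin' e i| := by
    simp only [habs]
    exact hmem.1.antitone
  simp only [lorentzNorm, sortedAbs_of_antitone hanti, habs]
  simp only [toLin'_coneMatrix_apply, Finset.mul_sum]
  rw [Finset.sum_comm]
  refine Finset.sum_congr rfl fun j _ => ?_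
  have hk : ∑ i : Fin n, (if i ≤ j then ((i : ℝ) + 1) ^ (1 / q - 1) else 0) =
      kappa q (j + 1) := by
    simp only [Fin.le_def]
    rw [Fin.sum_univ_eq_sum_range
      (fun i => if i ≤ (j : ℕ) then ((i : ℝ) + 1) ^ (1 / q - 1) else 0) n, kappa,
      ← Finset.sum_filter]
    refine Finset.sum_congr (Finset.ext fun i => ?_) fun _ _ => rfl
    have := j.isLt
    simp only [Finset.mem_filter, Finset.mem_range]
    omega
  calc ∑ i : Fin n, ((i : ℝ) + 1) ^ (1 / q - 1) * (if i ≤ j then e j / kappa q (j + 1) else 0)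
      = (∑ i : Fin n, if i ≤ j then ((i : ℝ) + 1) ^ (1 / q - 1) else 0) *
          (e j / kappa q (j + 1)) := by
        rw [Finset.sum_mul]
        refine Finset.sum_congr rfl fun i _ => ?_
        split_ifs <;> simp
    _ = e j := by
        rw [hk, mul_div_cancel₀ _ (kappa_succ_pos q j).ne']

lemma norm_toLin'_coneMatrix (q : ℝ) (hn : 0 < n) {e : Fin n → ℝ} (he : ∀ i, 0 < e i) :
    ‖(coneMatrix q n).toLin' e‖ = ∑ j : Fin n, e j / kappa q (j + 1) := by
  have hmem := (toLin'_coneMatrix_mem_decreasingCone q e).2 he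
  have h0 : (coneMatrix q n).toLin' e ⟨0, hn⟩ = ∑ j : Fin n, e j / kappa q (j + 1) := by
    rw [toLin'_coneMatrix_apply]
    exact Finset.sum_congr rfl fun j _ => if_pos (Fin.le_def.2 (Nat.zero_le _))
  rw [← h0]
  refine le_antisymm ((pi_norm_le_iff_of_nonneg (hmem.2 _).le).2 fun i => ?_) ?_
  · rw [Real.norm_eq_abs, abs_of_pos (hmem.2 i)]
    exact hmem.1.antitone (Fin.le_def.2 (Nat.zero_le _))
  · exact (le_abs_self _).trans (norm_le_pi_norm ((coneMatrix q n).toLin' e) ⟨0, hn⟩)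

lemma setLIntegral_decreasingCone (q : ℝ) {F : (Fin n → ℝ) → ℝ≥0∞} (hF : Measurable F) :
    ENNReal.ofReal |(coneMatrix q n).det⁻¹| * ∫⁻ x in decreasingCone n, F x =
      ∫⁻ e in {e : Fin n → ℝ | ∀ i, 0 < e i}, F ((coneMatrix q n).toLin' e) := by
  have hm : Measurable (coneMatrix q n).toLin' :=
    (LinearMap.continuous_on_pi _).measurable
  rw [← smul_eq_mul, ← lintegral_smul_measure, ← Measure.restrict_smul,
    ← Real.map_matrix_volume_pi_eq_smul_volume_pi (det_coneMatrix_ne_zero q n),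
    setLIntegral_map measurableSet_decreasingCone hF hm]
  congr 2
  ext e
  exact toLin'_coneMatrix_mem_decreasingCone q e
lemma scaledLorentzBall_eq (q : ℝ) (hn : 0 < n) :
    scaledLorentzBall q n = {x | lorentzNorm q x ≤ (n : ℝ) ^ (1 / q)} := by
  have hc : 0 < (n : ℝ) ^ (1 / q) := Real.rpow_pos_of_pos (Nat.cast_pos.2 hn) _
  ext x
  constructor
  · rintro ⟨y, hy, rfl⟩
    rw [Set.mem_ofPred_eq, lorentzNorm_smul q hc]
    exact mul_le_of_le_one_right hc.le hy
  · intro hx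
    refine ⟨((n : ℝ) ^ (1 / q))⁻¹ • x, ?_, smul_inv_smul₀ hc.ne' x⟩
    rw [lorentzBall, Set.mem_ofPred_eq, lorentzNorm_smul q (inv_pos.2 hc), inv_mul_le_iff₀ hc,
      mul_one]
    exact hx

lemma ae_pos_expMeasure_one : ∀ᵐ s ∂(expMeasure 1), 0 < s := by
  rw [expMeasure_one]
  exact (withDensity_absolutelyContinuous _ _).ae_le (ae_restrict_mem measurableSet_Ioi)

/-- The sup norm of a uniform vector in the normalized Lorentz ball, expressed through
independent standard exponential variables `s` and `e`. -/
def expRatio (q : ℝ) (n : ℕ) (p : ℝ × (Fin n → ℝ)) : ℝ :=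
  (n : ℝ) ^ (1 / q) / (∑ j, p.2 j + p.1) * ∑ j : Fin n, p.2 j / kappa q (j + 1)

lemma measurable_expRatio (q : ℝ) (n : ℕ) : Measurable (expRatio q n) := by
  unfold expRatio
  fun_prop

lemma exists_setLIntegral_norm_scaledLorentzBall (q : ℝ) (hn : 0 < n) :
    ∃ C : ℝ≥0∞, ∀ φ : ℝ → ℝ≥0∞, Measurable φ →
      C * ∫⁻ x in scaledLorentzBall q n, φ ‖x‖ =
        Fintype.card (Equiv.Perm (Fin n) × (Fin n → ℤˣ)) *
          ∫⁻ p, φ (expRatio q n p) ∂((expMeasure 1).prod (Measure.pi fun _ => expMeasure 1)) := by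
  set c : ℝ := (n : ℝ) ^ (1 / q)
  have hc : 0 < c := Real.rpow_pos_of_pos (Nat.cast_pos.2 hn) _
  have hLm := measurable_lorentzNorm (n := n) q
  obtain ⟨C, hC⟩ := exists_lintegral_exp_neg_gauge hLm (lorentzNorm_nonneg q)
    (fun t ht x => lorentzNorm_smul q ht x) hc
  refine ⟨ENNReal.ofReal |(coneMatrix q n).det⁻¹| * C, fun φ hφ => ?_⟩
  set F : (Fin n → ℝ) → ℝ≥0∞ := fun x => ENNReal.ofReal (Real.exp (-lorentzNorm q x)) *
    ∫⁻ s, φ ‖(c / (lorentzNorm q x + s)) • x‖ ∂(expMeasure 1) with hF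
  have hFm : Measurable F := by
    have h : Measurable fun p : (Fin n → ℝ) × ℝ =>
        φ ‖(c / (lorentzNorm q p.1 + p.2)) • p.1‖ := by
      have hL1 : Measurable fun p : (Fin n → ℝ) × ℝ => lorentzNorm q p.1 :=
        hLm.comp measurable_fst
      exact hφ.comp ((((hL1.add measurable_snd).const_div c).smul measurable_fst).norm)
    exact (hLm.neg.exp.ennreal_ofReal).mul h.lintegral_prod_right'
  have hφG : Measurable fun p => φ (expRatio q n p) := hφ.comp (measurable_expRatio q n)
  have hinv (g : Equiv.Perm (Fin n) × (Fin n → ℤˣ)) (x : Fin n → ℝ) :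
      F (signedPerm g x) = F x := by
    simp only [hF, lorentzNorm_signedPerm, norm_smul, norm_signedPerm]
  rw [scaledLorentzBall_eq q hn, mul_assoc, ← hC (fun x => φ ‖x‖) (hφ.comp measurable_norm),
    lintegral_eq_card_mul_setLIntegral_decreasingCone hFm hinv, mul_left_comm,
    setLIntegral_decreasingCone q hFm,
    lintegral_prod_symm' _ hφG,
    lintegral_pi_expMeasure_one hφG.lintegral_prod_left']
  congr 1
  refine setLIntegral_congr_fun (by measurability) fun e he => ?_
  have he : ∀ i, 0 < e i := he
  simp only [hF, lorentzNorm_toLin'_coneMatrix q he]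
  congr 1
  refine lintegral_congr_ae ?_
  filter_upwards [ae_pos_expMeasure_one] with s hs
  have hpos : 0 ≤ c / (∑ j, e j + s) := div_nonneg hc.le
    (add_nonneg (Finset.sum_nonneg fun i _ => (he i).le) hs.le)
  rw [norm_smul, norm_toLin'_coneMatrix q hn he, Real.norm_of_nonneg hpos]
  rfl

lemma map_norm_unifOn (q : ℝ) (hn : 0 < n)
    [IsProbabilityMeasure (unifOn (scaledLorentzBall q n))] :
    (unifOn (scaledLorentzBall q n)).map (fun x => ‖x‖) =
      ((expMeasure 1).prod (Measure.pi fun _ => expMeasure 1)).map (expRatio q n) := by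
  obtain ⟨C, hC⟩ := exists_setLIntegral_norm_scaledLorentzBall q hn
  set K := scaledLorentzBall q n
  have hv : (volume K)⁻¹ * volume K = 1 := by
    have := measure_univ (μ := unifOn K)
    rwa [unifOn, Measure.smul_apply, Measure.restrict_apply_univ, smul_eq_mul] at this
  have hK0 : volume K ≠ 0 := fun h => by simp [h] at hv
  have hKt : volume K ≠ ∞ := fun h => by simp [h] at hv
  have hCK : C * volume K = Fintype.card (Equiv.Perm (Fin n) × (Fin n → ℤˣ)) := by
    simpa using hC (fun _ => 1) measurable_const
  have hN0 : (Fintype.card (Equiv.Perm (Fin n) × (Fin n → ℤˣ)) : ℝ≥0∞) ≠ 0 :=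
    Nat.cast_ne_zero.2 Fintype.card_ne_zero
  have hC0 : C ≠ 0 := fun h => hN0 (by rw [← hCK, h, zero_mul])
  have hCt : C ≠ ∞ := fun h => by
    rw [h, ENNReal.top_mul hK0] at hCK
    exact ENNReal.natCast_ne_top _ hCK.symm
  refine Measure.ext_of_lintegral _ fun φ hφ => ?_
  rw [lintegral_map hφ measurable_norm, lintegral_map hφ (measurable_expRatio q n), unifOn,
    lintegral_smul_measure, smul_eq_mul]
  have h := hC φ hφ
  rw [← hCK, mul_assoc, ENNReal.mul_right_inj hC0 hCt] at h
  rw [h, ← mul_assoc, hv, one_mul]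

end Geometry

section Fluctuations

open ProbabilityTheory

lemma map_iidExp_head_tail (n : ℕ) :
    iidExp.map (fun ω => (ω 0, fun j : Fin n => ω (j + 1))) =
      (expMeasure 1).prod (Measure.pi fun _ => expMeasure 1) := by
  have h : iidExp.map (fun ω (i : Fin (n + 1)) => ω i) = Measure.pi fun _ => expMeasure 1 := by
    rw [iidExp, Measure.map_infinitePi_infinitePi_of_inj (P := fun _ : ℕ => expMeasure 1)
      Fin.val_injective, Measure.infinitePi_eq_pi]
  have hp := (measurePreserving_piFinSuccAbove (fun _ : Fin (n + 1) => expMeasure 1) 0).map_eq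
  rw [← h, Measure.map_map (by fun_prop) (by fun_prop)] at hp
  rw [← hp]
  rfl

lemma ae_pos_iidExp : ∀ᵐ ω ∂iidExp, ∀ i, 0 < ω i := by
  refine ae_all_iff.2 fun i => ?_
  have := ae_pos_expMeasure_one
  rw [← map_eval_iidExp i] at this
  exact ae_of_ae_map (measurable_pi_apply i).aemeasurable this

lemma centredWeight_sum_mul_div_eq (q : ℝ) {n : ℕ} (hn : 0 < n) {ω : ℕ → ℝ}
    (hω : ∀ i, 0 < ω i) :
    (∑ j ∈ range n, centredWeight q n j * ω (j + 1) + -(muqn q n * ω 0 / Real.sqrt n)) *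
        (n / ∑ j ∈ range (n + 1), ω j) =
      Real.sqrt n * (expRatio q n (ω 0, fun j => ω (j + 1)) - muqn q n) := by
  have hS : ∑ j ∈ range (n + 1), ω j ≠ 0 :=
    (Finset.sum_pos (fun i _ => hω i) ⟨0, by simp⟩).ne'
  have hr : Real.sqrt n ≠ 0 := (Real.sqrt_pos.2 (Nat.cast_pos.2 hn)).ne'
  have hn2 : (n : ℝ) = Real.sqrt n * Real.sqrt n := (Real.mul_self_sqrt n.cast_nonneg).symm
  have hsum : ∑ j ∈ range n, centredWeight q n j * ω (j + 1) =
      ((n : ℝ) ^ (1 / q) * ∑ j ∈ range n, ω (j + 1) / kappa q (j + 1) -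
        muqn q n * ∑ j ∈ range n, ω (j + 1)) / Real.sqrt n := by
    rw [Finset.mul_sum, Finset.mul_sum, ← Finset.sum_sub_distrib, Finset.sum_div]
    refine Finset.sum_congr rfl fun j _ => ?_
    rw [centredWeight]
    ring
  have hG : expRatio q n (ω 0, fun j => ω (j + 1)) =
      (n : ℝ) ^ (1 / q) / (∑ j ∈ range (n + 1), ω j) *
        ∑ j ∈ range n, ω (j + 1) / kappa q (j + 1) := by
    rw [expRatio, Fin.sum_univ_eq_sum_range (fun j => ω (j + 1)),
      Fin.sum_univ_eq_sum_range (fun j => ω (j + 1) / kappa q (j + 1)), Finset.sum_range_succ']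
  rw [hsum, hG]
  set A := ∑ j ∈ range n, ω (j + 1) / kappa q (j + 1)
  have hT : ∑ j ∈ range n, ω (j + 1) = ∑ j ∈ range (n + 1), ω j - ω 0 := by
    rw [Finset.sum_range_succ', add_sub_cancel_right]
  rw [hT]
  set S := ∑ j ∈ range (n + 1), ω j
  set c := (n : ℝ) ^ (1 / q)
  set r := Real.sqrt n
  rw [hn2]
  field_simp
  ring

lemma tendstoInDistribution_fluctuation {q : ℝ} (hq : 2 < q) :
    TendstoInDistribution (fun (n : ℕ) (ω : ℕ → ℝ) =>
      (∑ j ∈ range n, centredWeight q n j * ω (j + 1) + -(muqn q n * ω 0 / Real.sqrt n)) *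
        (n / ∑ j ∈ range (n + 1), ω j)) atTop (fun x : ℝ => x) (fun _ => iidExp)
      (gaussianReal 0 (1 / (q * (q - 1) ^ 2 * (q - 2))).toNNReal) := by
  have hv : 0 ≤ 1 / (q * (q - 1) ^ 2 * (q - 2)) :=
    one_div_nonneg.2 (mul_nonneg (mul_nonneg (by linarith) (sq_nonneg _)) (by linarith))
  have hε : Tendsto (fun n : ℕ => (n : ℝ) ^ (1 / q - 1 / 2)) atTop (nhds 0) := by
    have h : 0 < 1 / 2 - 1 / q := sub_pos.2 (one_div_lt_one_div_of_lt two_pos hq)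
    have := (tendsto_rpow_neg_atTop h).comp tendsto_natCast_atTop_atTop
    rwa [neg_sub] at this
  have hclt := tendstoInDistribution_weighted_sum_iidExp hv (sum_centredWeight q)
    (tendsto_sum_centredWeight_sq hq) hε fun n j hj => abs_centredWeight_le hj
  have hY : TendstoInMeasure iidExp (fun (n : ℕ) ω => -(muqn q n * ω 0 / Real.sqrt n)) atTop
      (fun _ => (0 : ℝ)) := by
    refine tendstoInMeasure_of_tendsto_ae
      (fun n => Measurable.aestronglyMeasurable (by fun_prop)) (ae_of_all _ fun ω => ?_)
    have h := ((tendsto_muqn hq).mul_const (ω 0)).div_atTop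
      (Real.tendsto_sqrt_atTop.comp tendsto_natCast_atTop_atTop)
    simpa using h.neg
  have hadd := hclt.add_of_tendstoInMeasure_const hY fun n => Measurable.aemeasurable (by fun_prop)
  have hmul := hadd.continuous_comp_prodMk_of_tendstoInMeasure_const
    (g := fun p : ℝ × ℝ => p.1 * p.2) (by fun_prop) tendstoInMeasure_div_sum_iidExp
    fun n => Measurable.aemeasurable (by fun_prop)
  simpa using hmul

end Fluctuations

/-- Theorem C (iii): for `2 < q < ∞` and `X̃^{(n)}` uniform on `D̃_{q,1}^n`,
`√n (‖X̃^{(n)}‖_∞ - μ_{q,n})` converges in distribution to `N(0, σ_q²)` with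
`σ_q² = 1/(q(q-1)²(q-2))`. Here `‖·‖` on `Fin n → ℝ` is the sup norm. -/
theorem fluctuations_sup_norm_large_q (q : ℝ) (hq : 2 < q)
    {Ω : Type*} [MeasurableSpace Ω] (P : Measure Ω) [IsProbabilityMeasure P]
    (X : (n : ℕ) → Ω → Fin n → ℝ) (hXmeas : ∀ n, Measurable (X n))
    (hX : ∀ n, Measure.map (X n) P = unifOn (scaledLorentzBall q n)) :
    ∀ f : ℝ → ℝ, Continuous f → (∃ C, ∀ x, |f x| ≤ C) →
      Tendsto (fun n : ℕ =>
          ∫ ω, f (Real.sqrt n * (‖X n ω‖ - muqn q n)) ∂P)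
        atTop (nhds (∫ x, f x
          ∂(ProbabilityTheory.gaussianReal 0 (1 / (q * (q - 1) ^ 2 * (q - 2))).toNNReal))) := by
  rintro f hf ⟨C, hC⟩
  have hD := tendstoInDistribution_fluctuation hq
  have h := ProbabilityMeasure.tendsto_iff_forall_integral_tendsto.1 hD.tendsto
    (BoundedContinuousFunction.ofNormedAddCommGroup f hf C hC)
  simp only [ProbabilityMeasure.coe_mk, BoundedContinuousFunction.coe_ofNormedAddCommGroup,
    Measure.map_id'] at h
  refine h.congr' ?_
  filter_upwards [eventually_gt_atTop 0] with n hn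
  have hprob : IsProbabilityMeasure (unifOn (scaledLorentzBall q n)) := by
    rw [← hX n]
    exact Measure.isProbabilityMeasure_map (hXmeas n).aemeasurable
  have hm : Measurable fun y : ℝ => f (Real.sqrt n * (y - muqn q n)) := by
    have := hf.measurable
    fun_prop
  have hHT : Measurable fun ω : ℕ → ℝ => (ω 0, fun j : Fin n => ω (j + 1)) := by fun_prop
  have hlaw : iidExp.map (fun ω => expRatio q n (ω 0, fun j => ω (j + 1))) =
      P.map fun ω => ‖X n ω‖ := by
    have h1 := map_norm_unifOn q hn
    rw [← hX n, Measure.map_map measurable_norm (hXmeas n), ← map_iidExp_head_tail,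
      Measure.map_map (measurable_expRatio q n) hHT] at h1
    exact h1.symm
  rw [integral_map (hD.forall_aemeasurable n) hf.aestronglyMeasurable,
    ← integral_map (φ := fun ω => ‖X n ω‖) (f := fun y => f (Real.sqrt n * (y - muqn q n)))
      (hXmeas n).norm.aemeasurable hm.aestronglyMeasurable, ← hlaw,
    integral_map (φ := fun ω : ℕ → ℝ => expRatio q n (ω 0, fun j => ω (j + 1)))
      ((measurable_expRatio q n).comp hHT).aemeasurable hm.aestronglyMeasurable]
  refine integral_congr_ae ?_
  filter_upwards [ae_pos_iidExp] with ω hω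
  rw [centredWeight_sum_mul_div_eq q hn hω]

end
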